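/- arXiv:1803.08824 — 2 statements merged into one kernel-verified Lean document; each statement's English description precedes it below -/
import Mathlib

section
/- Let sc_n be the number of equivalence classes of set compositions of [n] under the relation ∼ (π⃗ ∼ τ⃗ iff for every nonempty A ⊆ [n], #A_π⃗ = 1 ⟺ #A_τ⃗ = 1). Then the exponential generating function F(x) = Σ_{n≥0} sc_n x^n/n! equals e^x / (1 + (1+x)e^x − e^{2x}). -/
/-- A function `g : Fin n → Fin n` is *packed* if its set of used colors is a lower set;
packed functions encode exactly the set compositions of `[n]` (the blocks, in order, are the
level sets of `g`). -/
def IsPacked {n : ℕ} (g : Fin n → Fin n) : Prop :=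
  ∀ c : Fin n, (∃ i, g i = c) → ∀ d : Fin n, d ≤ c → ∃ i, g i = d

/-- Set compositions of `[n]`, encoded as packed functions. -/
abbrev SetComp (n : ℕ) := {g : Fin n → Fin n // IsPacked g}

/-- The set of minima `A_π⃗` of `A` in the set composition encoded by `g` is a singleton. -/
def UniqMin {n : ℕ} (g : Fin n → Fin n) (A : Finset (Fin n)) : Prop :=
  ∃! j, j ∈ A ∧ ∀ k ∈ A, g j ≤ g k

/-- The SC equivalence relation: `π⃗ ∼ τ⃗` iff for every nonempty `A ⊆ [n]`,
`#A_π⃗ = 1 ↔ #A_τ⃗ = 1`. -/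
def SimSC {n : ℕ} (π τ : SetComp n) : Prop :=
  ∀ A : Finset (Fin n), A.Nonempty → (UniqMin π.1 A ↔ UniqMin τ.1 A)

/-- `sc n`: the number of equivalence classes of set compositions of `[n]` under `∼`. -/
noncomputable def scN (n : ℕ) : ℕ :=
  Nat.card (Quot (fun π τ : SetComp n => SimSC π τ))

/-- Subsets of `S` with a unique `g`-minimum. -/
noncomputable def UF {n : ℕ} (g : Fin n → ℕ) (S : Finset (Fin n)) : Finset (Finset (Fin n)) := by
  classical
  exact S.powerset.filter (fun A => ∃! j, j ∈ A ∧ ∀ k ∈ A, g j ≤ g k)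

theorem mem_UF {n : ℕ} {g : Fin n → ℕ} {S A : Finset (Fin n)} :
    A ∈ UF g S ↔ A ⊆ S ∧ ∃! j, j ∈ A ∧ ∀ k ∈ A, g j ≤ g k := by
  classical
  simp [UF]

/-- The lowest level of `g` on `S` is not a singleton. -/
def Zr {n : ℕ} (g : Fin n → ℕ) (S : Finset (Fin n)) : Prop :=
  S.Nonempty → ∃ y ∈ S, ∃ z ∈ S, y ≠ z ∧ g y = g z ∧ ∀ k ∈ S, g y ≤ g k

noncomputable def Fam {n : ℕ} (S : Finset (Fin n)) : Finset (Finset (Finset (Fin n))) := by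
  classical
  exact Finset.univ.filter (fun U => ∃ g, U = UF g S)

noncomputable def FamZ {n : ℕ} (S : Finset (Fin n)) : Finset (Finset (Finset (Fin n))) := by
  classical
  exact Finset.univ.filter (fun U => ∃ g, Zr g S ∧ U = UF g S)

theorem mem_Fam {n : ℕ} {S : Finset (Fin n)} {U} : U ∈ Fam S ↔ ∃ g, U = UF g S := by
  classical
  simp [Fam]

theorem mem_FamZ {n : ℕ} {S : Finset (Fin n)} {U} : U ∈ FamZ S ↔ ∃ g, Zr g S ∧ U = UF g S := by
  classical
  simp [FamZ]

theorem card_Fam {n : ℕ} (S : Finset (Fin n)) :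
    (Fam S).card = ∑ T ∈ S.powerset, (FamZ T).card := by
  classical
  rw [← Finset.card_sigma]
  symm
  refine Finset.card_bij
    (fun p _ => S.powerset.filter (fun A => (∃ x ∈ A, x ∉ p.1) ∨ A ∈ p.2)) ?_ ?_ ?_
  · rintro ⟨T, U⟩ hp
    simp only [Finset.mem_sigma, Finset.mem_powerset, mem_FamZ] at hp
    obtain ⟨hT, g, hZ, rfl⟩ := hp
    rw [mem_Fam]
    refine ⟨fun x => if x ∈ T then g x + n else x.val, ?_⟩
    ext A
    simp only [Finset.mem_filter, Finset.mem_powerset, mem_UF]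
    refine and_congr_right fun hA => ?_
    by_cases hAT : A ⊆ T
    · have h1 : ¬ ∃ x ∈ A, x ∉ T := by
        rintro ⟨x, hx, hx'⟩; exact hx' (hAT hx)
      simp only [h1, hAT, true_and, false_or]
      refine existsUnique_congr fun j => and_congr_right fun hj => ?_
      refine forall₂_congr fun k hk => ?_
      simp [hAT hj, hAT hk]
    · have h1 : ∃ x ∈ A, x ∉ T := by
        simpa [Finset.subset_iff] using hAT
      simp only [h1, true_or, true_iff]
      have h2 : (A.filter (fun x => x ∉ T)).Nonempty := by
        obtain ⟨x, hx, hx'⟩ := h1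
        exact ⟨x, by simp [hx, hx']⟩
      obtain ⟨m, hm, hmin⟩ := Finset.exists_min_image _ (fun x : Fin n => x.val) h2
      simp only [Finset.mem_filter] at hm hmin
      refine ⟨m, ⟨hm.1, ?_⟩, ?_⟩
      · intro k hk
        by_cases hkT : k ∈ T
        · simp only [hm.2, hkT, if_true, if_false]; omega
        · simp only [hm.2, hkT, if_false]; exact hmin k ⟨hk, hkT⟩
      · rintro j ⟨hj, hj'⟩
        have := hj' m hm.1
        by_cases hjT : j ∈ T
        · simp only [hm.2, hjT, if_true, if_false] at this; omega
        · simp only [hm.2, hjT, if_false] at this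
          have := hmin j ⟨hj, hjT⟩
          ext; omega
  · have key : ∀ (T T' : Finset (Fin n)) (U U' : Finset (Finset (Fin n))), T ⊆ S → T' ⊆ S →
        U ∈ FamZ T → U' ∈ FamZ T' →
        S.powerset.filter (fun A => (∃ x ∈ A, x ∉ T) ∨ A ∈ U) =
        S.powerset.filter (fun A => (∃ x ∈ A, x ∉ T') ∨ A ∈ U') → T' ⊆ T := by
      intro T T' U U' hT hT' hU hU' h x hx
      by_contra hxT
      obtain ⟨g, hZ, rfl⟩ := mem_FamZ.1 hU'
      obtain ⟨y, hy, z, hz, hne, hyz, hmin⟩ := hZ ⟨x, hx⟩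
      have hsub : ({x, y, z} : Finset (Fin n)) ⊆ T' := by
        intro w hw
        simp only [Finset.mem_insert, Finset.mem_singleton] at hw
        rcases hw with rfl | rfl | rfl <;> assumption
      have h1 : ({x, y, z} : Finset (Fin n)) ∈
          S.powerset.filter (fun A => (∃ x ∈ A, x ∉ T) ∨ A ∈ U) := by
        simp only [Finset.mem_filter, Finset.mem_powerset]
        exact ⟨hsub.trans hT', Or.inl ⟨x, by simp, hxT⟩⟩
      rw [h] at h1
      simp only [Finset.mem_filter] at h1
      rcases h1.2 with ⟨w, hw, hw'⟩ | h2
      · exact hw' (hsub hw)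
      · obtain ⟨-, hu⟩ := mem_UF.1 h2
        exact hne (hu.unique ⟨by simp, fun k hk => hmin k (hsub hk)⟩
          ⟨by simp, fun k hk => hyz ▸ hmin k (hsub hk)⟩)
    rintro ⟨T, U⟩ hp ⟨T', U'⟩ hp' h
    simp only [Finset.mem_sigma, Finset.mem_powerset] at hp hp'
    have hTT : T = T' := Finset.Subset.antisymm (key _ _ _ _ hp'.1 hp.1 hp'.2 hp.2 h.symm)
      (key _ _ _ _ hp.1 hp'.1 hp.2 hp'.2 h)
    subst hTT
    have sub : ∀ V ∈ FamZ T, ∀ A ∈ V, A ⊆ T := by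
      intro V hV A hA
      obtain ⟨g, -, rfl⟩ := mem_FamZ.1 hV
      exact (mem_UF.1 hA).1
    have : U = U' := by
      ext A
      by_cases hA : A ⊆ T
      · have h3 := Finset.ext_iff.1 h A
        have h1 : ¬ ∃ x ∈ A, x ∉ T := by
          rintro ⟨x, hx, hx'⟩; exact hx' (hA hx)
        simpa [h1, hA.trans hp.1] using h3
      · exact ⟨fun h => (hA (sub _ hp.2 _ h)).elim, fun h => (hA (sub _ hp'.2 _ h)).elim⟩
    subst this
    rfl
  · intro V hV
    obtain ⟨g, rfl⟩ := mem_Fam.1 hV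
    set T := S.filter (fun x => ∃ y ∈ S, ∃ z ∈ S, y ≠ z ∧ g y = g z ∧ g y ≤ g x) with hTdef
    have hTm : ∀ x, x ∈ T ↔ x ∈ S ∧ ∃ y ∈ S, ∃ z ∈ S, y ≠ z ∧ g y = g z ∧ g y ≤ g x := by
      intro x; simp [hTdef]
    have hTS : T ⊆ S := Finset.filter_subset _ _
    refine ⟨⟨T, UF g T⟩, ?_, ?_⟩
    · simp only [Finset.mem_sigma, Finset.mem_powerset, mem_FamZ]
      refine ⟨hTS, g, ?_, rfl⟩
      intro hne
      obtain ⟨m, hm, hmin⟩ := Finset.exists_min_image T g hne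
      obtain ⟨hmS, y, hy, z, hz, hyz, he, hle⟩ := (hTm m).1 hm
      refine ⟨y, (hTm y).2 ⟨hy, y, hy, z, hz, hyz, he, le_rfl⟩,
        z, (hTm z).2 ⟨hz, y, hy, z, hz, hyz, he, he.le⟩, hyz, he, ?_⟩
      intro k hk
      exact hle.trans (hmin k hk)
    · ext A
      simp only [Finset.mem_filter, Finset.mem_powerset, mem_UF]
      refine and_congr_right fun hA => ?_
      by_cases hAT : A ⊆ T
      · have h1 : ¬ ∃ x ∈ A, x ∉ T := by
          rintro ⟨x, hx, hx'⟩; exact hx' (hAT hx)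
        simp only [h1, hAT, true_and, false_or]
      · have h1 : ∃ x ∈ A, x ∉ T := by
          simpa [Finset.subset_iff] using hAT
        simp only [h1, true_or, true_iff]
        obtain ⟨x, hx, hxT⟩ := h1
        obtain ⟨m, hm, hmin⟩ := Finset.exists_min_image A g ⟨x, hx⟩
        refine ⟨m, ⟨hm, hmin⟩, ?_⟩
        rintro j ⟨hj, hj'⟩
        by_contra hne
        exact hxT ((hTm x).2 ⟨hA hx, j, hA hj, m, hA hm, hne,
          le_antisymm (hj' m hm) (hmin j hj), hj' x hx⟩)

theorem card_FamZ {n : ℕ} (S : Finset (Fin n)) (hS : S.Nonempty) :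
    (FamZ S).card = ∑ T ∈ S.powerset, if T.card + 2 ≤ S.card then (Fam T).card else 0 := by
  classical
  rw [← Finset.sum_filter, ← Finset.card_sigma]
  symm
  refine Finset.card_bij
    (fun p _ => S.powerset.filter (fun A => (∃! x, x ∈ A ∧ x ∉ p.1) ∨ A ∈ p.2)) ?_ ?_ ?_
  · rintro ⟨T, U⟩ hp
    simp only [Finset.mem_sigma, Finset.mem_filter, Finset.mem_powerset, mem_Fam] at hp
    obtain ⟨⟨hT, hc⟩, g, rfl⟩ := hp
    rw [mem_FamZ]
    refine ⟨fun x => if x ∈ T then g x + 1 else 0, ?_, ?_⟩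
    · intro _
      have : 1 < (S \ T).card := by
        rw [Finset.card_sdiff_of_subset hT]; omega
      obtain ⟨y, hy, z, hz, hne⟩ := Finset.one_lt_card.1 this
      simp only [Finset.mem_sdiff] at hy hz
      exact ⟨y, hy.1, z, hz.1, hne, by simp [hy.2, hz.2], by simp [hy.2]⟩
    ext A
    simp only [Finset.mem_filter, Finset.mem_powerset, mem_UF]
    refine and_congr_right fun hA => ?_
    by_cases hAT : A ⊆ T
    · have h1 : ¬ ∃! x, x ∈ A ∧ x ∉ T := by
        rintro ⟨x, ⟨hx, hx'⟩, -⟩; exact hx' (hAT hx)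
      simp only [h1, hAT, true_and, false_or]
      refine existsUnique_congr fun j => and_congr_right fun hj => ?_
      refine forall₂_congr fun k hk => ?_
      simp [hAT hj, hAT hk]
    · have h1 : ∃ x ∈ A, x ∉ T := by
        simpa [Finset.subset_iff] using hAT
      simp only [hAT, false_and, or_false]
      obtain ⟨x, hx, hxT⟩ := h1
      refine existsUnique_congr fun j => and_congr_right fun hj => ?_
      constructor
      · intro h k hk; simp [h]
      · intro h hjT
        have := h x hx
        simp [hjT, hxT] at this
  · have key : ∀ (T T' : Finset (Fin n)) (U U' : Finset (Finset (Fin n))), T ⊆ S → T' ⊆ S →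
        T'.card + 2 ≤ S.card →
        U ∈ Fam T → U' ∈ Fam T' →
        S.powerset.filter (fun A => (∃! x, x ∈ A ∧ x ∉ T) ∨ A ∈ U) =
        S.powerset.filter (fun A => (∃! x, x ∈ A ∧ x ∉ T') ∨ A ∈ U') → T' ⊆ T := by
      intro T T' U U' hT hT' hc' hU hU' h x hx
      by_contra hxT
      obtain ⟨g, rfl⟩ := mem_Fam.1 hU
      obtain ⟨g', rfl⟩ := mem_Fam.1 hU'
      have h3 := Finset.ext_iff.1 h
      simp only [Finset.mem_filter, Finset.mem_powerset, and_congr_right_iff] at h3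
      by_cases hy : ∃ y ∈ S, y ∉ T ∧ y ∉ T'
      · obtain ⟨y, hyS, hyT, hyT'⟩ := hy
        have hxy : x ≠ y := fun e => hyT' (e ▸ hx)
        have h4 := (h3 {x, y} (by
          intro w hw
          simp only [Finset.mem_insert, Finset.mem_singleton] at hw
          rcases hw with rfl | rfl
          · exact hT' hx
          · exact hyS)).2 (Or.inl ⟨y, ⟨by simp, hyT'⟩, by
            rintro w ⟨hw, hw'⟩
            simp only [Finset.mem_insert, Finset.mem_singleton] at hw
            rcases hw with rfl | rfl
            · exact (hw' hx).elim
            · rfl⟩)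
        rcases h4 with h4 | h4
        · exact hxy (h4.unique ⟨by simp, hxT⟩ ⟨by simp, hyT⟩)
        · exact hxT ((mem_UF.1 h4).1 (by simp))
      · push Not at hy
        have : 1 < (S \ T').card := by
          rw [Finset.card_sdiff_of_subset hT']; omega
        obtain ⟨y, hyy, z, hz, hne⟩ := Finset.one_lt_card.1 this
        have h4 := (h3 (insert x (S \ T')) (by
          intro w hw
          simp only [Finset.mem_insert, Finset.mem_sdiff] at hw
          rcases hw with rfl | hw
          · exact hT' hx
          · exact hw.1)).1 (Or.inl ⟨x, ⟨by simp, hxT⟩, by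
            rintro w ⟨hw, hw'⟩
            simp only [Finset.mem_insert, Finset.mem_sdiff] at hw
            rcases hw with rfl | hw
            · rfl
            · exact (hw.2 (hy w hw.1 hw')).elim⟩)
        rcases h4 with h4 | h4
        · exact hne (h4.unique ⟨Finset.mem_insert_of_mem hyy, (Finset.mem_sdiff.1 hyy).2⟩
            ⟨Finset.mem_insert_of_mem hz, (Finset.mem_sdiff.1 hz).2⟩)
        · exact (Finset.mem_sdiff.1 hyy).2 ((mem_UF.1 h4).1 (Finset.mem_insert_of_mem hyy))
    rintro ⟨T, U⟩ hp ⟨T', U'⟩ hp' h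
    simp only [Finset.mem_sigma, Finset.mem_filter, Finset.mem_powerset] at hp hp'
    have hTT : T = T' := Finset.Subset.antisymm
      (key _ _ _ _ hp'.1.1 hp.1.1 hp.1.2 hp'.2 hp.2 h.symm)
      (key _ _ _ _ hp.1.1 hp'.1.1 hp'.1.2 hp.2 hp'.2 h)
    subst hTT
    have sub : ∀ V ∈ Fam T, ∀ A ∈ V, A ⊆ T := by
      intro V hV A hA
      obtain ⟨g, rfl⟩ := mem_Fam.1 hV
      exact (mem_UF.1 hA).1
    have : U = U' := by
      ext A
      by_cases hA : A ⊆ T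
      · have h3 := Finset.ext_iff.1 h A
        have h1 : ¬ ∃! x, x ∈ A ∧ x ∉ T := by
          rintro ⟨x, ⟨hx, hx'⟩, -⟩; exact hx' (hA hx)
        simpa only [Finset.mem_filter, Finset.mem_powerset, h1, hA.trans hp.1.1, true_and,
          false_or] using h3
      · exact ⟨fun h => (hA (sub _ hp.2 _ h)).elim, fun h => (hA (sub _ hp'.2 _ h)).elim⟩
    subst this
    rfl
  · intro V hV
    obtain ⟨g, hZ, rfl⟩ := mem_FamZ.1 hV
    obtain ⟨y, hy, z, hz, hne, hyz, hmin⟩ := hZ hS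
    set T := S.filter (fun x => g y < g x) with hTdef
    have hTm : ∀ x, x ∈ T ↔ x ∈ S ∧ g y < g x := by
      intro x; simp [hTdef]
    have hTS : T ⊆ S := Finset.filter_subset _ _
    refine ⟨⟨T, UF g T⟩, ?_, ?_⟩
    · simp only [Finset.mem_sigma, Finset.mem_filter, Finset.mem_powerset, mem_Fam]
      refine ⟨⟨hTS, ?_⟩, g, rfl⟩
      have : 1 < (S \ T).card := Finset.one_lt_card.2
        ⟨y, by simp [hTm, hy], z, by simp [hTm, hz, hyz], hne⟩
      rw [Finset.card_sdiff_of_subset hTS] at this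
      omega
    · ext A
      simp only [Finset.mem_filter, Finset.mem_powerset, mem_UF]
      refine and_congr_right fun hA => ?_
      by_cases hAT : A ⊆ T
      · have h1 : ¬ ∃! x, x ∈ A ∧ x ∉ T := by
          rintro ⟨x, ⟨hx, hx'⟩, -⟩; exact hx' (hAT hx)
        simp only [h1, hAT, true_and, false_or]
      · have h1 : ∃ x ∈ A, x ∉ T := by
          simpa [Finset.subset_iff] using hAT
        simp only [hAT, false_and, or_false]
        obtain ⟨x, hx, hxT⟩ := h1
        have low : ∀ w ∈ S, w ∉ T → g w ≤ g y := by
          intro w hw hwT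
          by_contra hlt
          exact hwT ((hTm w).2 ⟨hw, not_le.1 hlt⟩)
        refine existsUnique_congr fun j => and_congr_right fun hj => ?_
        constructor
        · intro h k hk; exact (low j (hA hj) h).trans (hmin k (hA hk))
        · intro h hjT
          have h5 := h x hx
          have h6 := low x (hA hx) hxT
          have h7 := ((hTm j).1 hjT).2
          omega

theorem exists_packed {n : ℕ} (g : Fin n → ℕ) :
    ∃ h : SetComp n, ∀ x y, h.1 x ≤ h.1 y ↔ g x ≤ g y := by
  classical
  set S := Finset.univ.image g with hS
  have hc : S.card ≤ n := by
    simpa using (Finset.card_image_le (s := Finset.univ) (f := g))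
  have hm : ∀ x, g x ∈ S := fun x => Finset.mem_image_of_mem _ (Finset.mem_univ x)
  let e := S.orderIsoOfFin rfl
  refine ⟨⟨fun x => Fin.castLE hc (e.symm ⟨g x, hm x⟩), ?_⟩, ?_⟩
  · rintro c ⟨i, rfl⟩ d hd
    have hd' : d.val < S.card := by
      have h1 : d.val ≤ (e.symm ⟨g i, hm i⟩).val := hd
      exact h1.trans_lt (Fin.isLt _)
    obtain ⟨j, -, hj⟩ := Finset.mem_image.1 (e ⟨d.val, hd'⟩).2
    refine ⟨j, ?_⟩
    have : (⟨g j, hm j⟩ : S) = e ⟨d.val, hd'⟩ := Subtype.ext hj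
    beta_reduce
    rw [this]
    simp
  · intro x y
    have : e.symm ⟨g x, hm x⟩ ≤ e.symm ⟨g y, hm y⟩ ↔ g x ≤ g y := by
      rw [e.symm.le_iff_le]; rfl
    exact this

theorem mem_UF_univ {n : ℕ} (g : Fin n → Fin n) (A : Finset (Fin n)) :
    A ∈ UF (fun x => (g x).val) Finset.univ ↔ UniqMin g A := by
  rw [mem_UF]
  simp [UniqMin]

theorem scN_eq (n : ℕ) : scN n = (Fam (Finset.univ : Finset (Fin n))).card := by
  classical
  rw [scN, ← Nat.card_eq_finsetCard]
  have hnil : ∀ g : Fin n → Fin n, ¬ UniqMin g ∅ := by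
    rintro g ⟨j, ⟨hj, -⟩, -⟩
    simp at hj
  refine Nat.card_congr (Equiv.ofBijective (Quot.lift
    (fun π => (⟨UF (fun x => (π.1 x).val) Finset.univ, mem_Fam.2 ⟨_, rfl⟩⟩ :
      Fam (Finset.univ : Finset (Fin n)))) ?_) ⟨?_, ?_⟩)
  · intro π τ h
    apply Subtype.ext
    ext A
    simp only [mem_UF_univ]
    rcases A.eq_empty_or_nonempty with rfl | hA
    · simp [hnil]
    · exact h A hA
  · rintro ⟨π⟩ ⟨τ⟩ h
    apply Quot.sound
    intro A _
    have := Finset.ext_iff.1 (Subtype.ext_iff.1 h) A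
    simpa only [mem_UF_univ] using this
  · rintro ⟨U, hU⟩
    obtain ⟨g, rfl⟩ := mem_Fam.1 hU
    obtain ⟨h, hh⟩ := exists_packed g
    refine ⟨Quot.mk _ h, Subtype.ext ?_⟩
    ext A
    change A ∈ UF (fun x => (h.1 x).val) Finset.univ ↔ _
    rw [mem_UF_univ, mem_UF]
    simp [UniqMin, hh]

/-- Number of families on an `n`-set whose lowest level is not a singleton. -/
def bN (n : ℕ) : ℕ :=
  if n = 0 then 1 else
    ∑ k : Fin (n + 1), if h : k.val + 2 ≤ n then
      n.choose k.val * ∑ j : Fin (k.val + 1), k.val.choose j.val * bN j.val else 0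
termination_by n
decreasing_by have := j.isLt; omega

def aN (n : ℕ) : ℕ := ∑ j ∈ Finset.range (n + 1), n.choose j * bN j

theorem bN_eq (n : ℕ) (hn : n ≠ 0) :
    bN n = ∑ k ∈ Finset.range (n + 1), n.choose k * if k + 2 ≤ n then aN k else 0 := by
  rw [bN, if_neg hn, Finset.sum_range]
  refine Finset.sum_congr rfl fun k _ => ?_
  split_ifs with h
  · rw [aN, Finset.sum_range]
  · simp

theorem card_Z_eq {n : ℕ} (m : ℕ) : ∀ S : Finset (Fin n), S.card = m → (FamZ S).card = bN m := by
  classical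
  induction m using Nat.strong_induction_on with
  | _ m ih =>
    intro S hS
    rcases S.eq_empty_or_nonempty with rfl | hne
    · have h0 : m = 0 := by simpa using hS.symm
      subst h0
      rw [bN, if_pos rfl, Finset.card_eq_one]
      refine ⟨UF (fun _ => 0) ∅, ?_⟩
      ext U
      rw [mem_FamZ, Finset.mem_singleton]
      constructor
      · rintro ⟨g, -, rfl⟩
        ext A
        simp only [mem_UF, Finset.subset_empty]
        constructor
        · rintro ⟨rfl, h⟩; obtain ⟨j, hj, -⟩ := h; simp at hj
        · rintro ⟨rfl, h⟩; obtain ⟨j, hj, -⟩ := h; simp at hj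
      · intro h
        exact ⟨_, fun h => by simp at h, h⟩
    · have hm : m ≠ 0 := by
        rw [← hS]; exact hne.card_ne_zero
      rw [card_FamZ S hne, bN_eq m hm]
      have : ∀ T ∈ S.powerset, (if T.card + 2 ≤ S.card then (Fam T).card else 0) =
          (fun k => if k + 2 ≤ m then aN k else 0) T.card := by
        intro T hT
        simp only [hS]
        split_ifs with h
        · rw [card_Fam]
          have h2 : ∀ R ∈ T.powerset, (FamZ R).card = bN R.card := by
            intro R hR
            have := Finset.card_le_card (Finset.mem_powerset.1 hR)
            exact ih R.card (by omega) R rfl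
          rw [Finset.sum_congr rfl h2, Finset.sum_powerset_apply_card]
          simp [aN]
        · rfl
      rw [Finset.sum_congr rfl this,
        Finset.sum_powerset_apply_card (fun k => if k + 2 ≤ m then aN k else 0), hS]
      simp only [smul_eq_mul]

theorem scN_aN (n : ℕ) : scN n = aN n := by
  rw [scN_eq, card_Fam, Finset.sum_congr rfl (fun T _ => card_Z_eq T.card T rfl),
    Finset.sum_powerset_apply_card]
  simp [aN]

theorem egf_a : (PowerSeries.mk fun n => (aN n : ℚ) / n.factorial) =
    (PowerSeries.mk fun n => (bN n : ℚ) / n.factorial) * PowerSeries.exp ℚ := by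
  ext n
  rw [PowerSeries.coeff_mul, Finset.Nat.sum_antidiagonal_eq_sum_range_succ_mk]
  simp only [PowerSeries.coeff_mk, PowerSeries.coeff_exp, aN]
  push_cast
  rw [Finset.sum_div]
  refine Finset.sum_congr rfl fun k hk => ?_
  have hk' : k ≤ n := by simpa [Nat.lt_succ_iff] using hk
  rw [Nat.cast_choose ℚ hk']
  have h1 : (n.factorial : ℚ) ≠ 0 := by positivity
  have h2 : (k.factorial : ℚ) ≠ 0 := by positivity
  have h3 : ((n - k).factorial : ℚ) ≠ 0 := by positivity
  simp
  field_simp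

theorem egf_b : (PowerSeries.mk fun n => (bN n : ℚ) / n.factorial) =
    1 + (PowerSeries.mk fun n => (aN n : ℚ) / n.factorial) *
      (PowerSeries.exp ℚ - 1 - PowerSeries.X) := by
  have hU : ∀ i, PowerSeries.coeff i (PowerSeries.exp ℚ - 1 - PowerSeries.X) =
      if 2 ≤ i then 1 / (i.factorial : ℚ) else 0 := by
    intro i
    rcases i with _ | _ | i
    · simp
    · simp [PowerSeries.coeff_one, PowerSeries.coeff_exp]
    · simp [PowerSeries.coeff_one, PowerSeries.coeff_X, PowerSeries.coeff_exp]
  ext n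
  rw [map_add, PowerSeries.coeff_mul, Finset.Nat.sum_antidiagonal_eq_sum_range_succ_mk]
  simp only [PowerSeries.coeff_mk, hU, PowerSeries.coeff_one]
  by_cases hn : n = 0
  · subst hn
    simp [bN]
  · rw [bN_eq n hn, if_neg hn, zero_add]
    push_cast
    rw [Finset.sum_div]
    refine Finset.sum_congr rfl fun k hk => ?_
    have hk' : k ≤ n := by simpa [Nat.lt_succ_iff] using hk
    rw [Nat.cast_choose ℚ hk']
    have h1 : (n.factorial : ℚ) ≠ 0 := by positivity
    have h2 : (k.factorial : ℚ) ≠ 0 := by positivity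
    have h3 : ((n - k).factorial : ℚ) ≠ 0 := by positivity
    by_cases h : k + 2 ≤ n
    · rw [if_pos h, if_pos (by omega)]
      field_simp
    · rw [if_neg h, if_neg (by omega)]
      simp

/-- The exponential generating function of `sc_n` equals
`e^x / (1 + (1+x)e^x − e^{2x})`. -/
theorem stmt14 :
    (PowerSeries.mk fun n => (scN n : ℚ) / n.factorial) =
      PowerSeries.exp ℚ *
        (1 + (1 + PowerSeries.X) * PowerSeries.exp ℚ -
            PowerSeries.rescale 2 (PowerSeries.exp ℚ))⁻¹ := by
  have hE : PowerSeries.rescale 2 (PowerSeries.exp ℚ) = PowerSeries.exp ℚ ^ 2 := by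
    have := PowerSeries.exp_pow_eq_rescale_exp (A := ℚ) 2
    simpa using this.symm
  simp only [scN_aN]
  rw [PowerSeries.eq_mul_inv_iff_mul_eq (by simp [hE]), hE]
  have ha := egf_a
  rw [egf_b] at ha
  linear_combination ha
end

section
/- Let G be a graph, λ ⊢ |V(G)|, and for S ⊆ E(G) let τ(S) be the partition of component sizes of (V(G), S). Writing Ψ(G) = Σ_λ c_λ p_λ in the power-sum basis (so c_λ = Σ_{S : τ(S)=λ} (−1)^{#S}), the matching sums satisfy Σ_{m ∈ ℳ_k(G)} Ψ(G ∖ 𝒩(m)) = Σ_{λ ⊢ n−2k} p_λ (−1)^k c_{λ ∪ (2^k)} · binom(m_2(λ)+k, k) · k!, where ℳ_k(G) is the set of ordered k-edge matchings, G ∖ 𝒩(m) deletes the matched vertices and incident edges, m_2(λ) is the number of parts of λ equal to 2, and λ ∪ (2^k) adds k parts of size 2. In particular, if Ψ(G_1) = Ψ(G_2) then Σ_{m ∈ ℳ_k(G_1)} Ψ(G_1 ∖ 𝒩(m)) = Σ_{m ∈ ℳ_k(G_2)} Ψ(G_2 ∖ 𝒩(m)). -/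
open scoped Classical

noncomputable section

/-- The chromatic symmetric function of a finite graph, as a power series in commuting
variables `x_0, x_1, …`. -/
def chromPS {V : Type*} [Fintype V] (G : SimpleGraph V) : MvPowerSeries ℕ ℚ :=
  fun d => (Nat.card {f : V → ℕ // (∀ v w, G.Adj v w → f v ≠ f w) ∧
    ∀ c : ℕ, Nat.card {v : V // f v = c} = d c} : ℚ)

/-- The power-sum symmetric function `p_r = ∑_i x_i^r`, as a power series. -/
def pPow (r : ℕ) : MvPowerSeries ℕ ℚ :=
  fun d => if ∃ i : ℕ, d = Finsupp.single i r then (1 : ℚ) else 0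

/-- The power-sum symmetric function `p_λ = ∏_{r ∈ λ} p_r` of an integer partition. -/
def pPart {m : ℕ} (lam : Nat.Partition m) : MvPowerSeries ℕ ℚ :=
  (lam.parts.map pPow).prod

/-- The integer partition `τ(G)` of connected-component sizes of a graph `G`. -/
def compPartition {V : Type*} [Fintype V] (G : SimpleGraph V) :
    Nat.Partition (Fintype.card V) where
  parts := (Finset.univ : Finset G.ConnectedComponent).val.map fun c => Nat.card c.supp
  parts_pos := by
    intro p hp
    simp only [Multiset.mem_map] at hp
    obtain ⟨c, -, rfl⟩ := hp
    obtain ⟨v, hv⟩ := c.exists_rep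
    have : Nonempty c.supp :=
      ⟨⟨v, by simp only [SimpleGraph.ConnectedComponent.mem_supp_iff]; exact hv⟩⟩
    exact Nat.card_pos
  parts_sum := by
    have h1 : ((Finset.univ : Finset G.ConnectedComponent).val.map
        fun c => Nat.card c.supp).sum
        = ∑ c : G.ConnectedComponent, Nat.card c.supp := rfl
    rw [h1]
    calc ∑ c : G.ConnectedComponent, Nat.card c.supp
        = ∑ c : G.ConnectedComponent,
            (Finset.univ.filter fun v : V => G.connectedComponentMk v = c).card := by
          refine Finset.sum_congr rfl fun c _ => ?_
          rw [Nat.card_eq_fintype_card, Fintype.card_subtype]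
          congr 1
          ext v
          simp [SimpleGraph.ConnectedComponent.mem_supp_iff]
      _ = (Finset.univ : Finset V).card :=
          (Finset.card_eq_sum_card_fiberwise fun x _ => Finset.mem_univ _).symm
      _ = Fintype.card V := by simp

/-- The coefficient `c_λ` of `p_λ` in the power-sum expansion of `Ψ(G)`:
`c_λ = ∑_{S ⊆ E(G), τ(S) = λ} (−1)^{#S}` (Stanley). -/
def cCoef {V : Type*} [Fintype V] (G : SimpleGraph V)
    (lam : Nat.Partition (Fintype.card V)) : ℚ :=
  ∑ S ∈ G.edgeFinset.powerset,
    if compPartition (SimpleGraph.fromEdgeSet (↑S : Set (Sym2 V))) = lam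
      then (-1 : ℚ) ^ S.card else 0

/-- Ordered matchings of size `k` in `G`: tuples of `k` pairwise vertex-disjoint edges. -/
abbrev Matchings {V : Type*} [Fintype V] (G : SimpleGraph V) (k : ℕ) :=
  {m : Fin k → Sym2 V // (∀ i, m i ∈ G.edgeSet) ∧
    ∀ i j, i ≠ j → ∀ v : V, ¬(v ∈ m i ∧ v ∈ m j)}

/-- `m₂(λ)`: the number of parts of `λ` equal to `2`. -/
def mTwo {m : ℕ} (lam : Nat.Partition m) : ℕ := lam.parts.count 2

/-- `λ ∪ (2^k)`: add `k` parts of size `2` to `λ`. -/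
def addTwos {m k : ℕ} (h : 2 * k ≤ m) (lam : Nat.Partition (m - 2 * k)) :
    Nat.Partition m where
  parts := lam.parts + Multiset.replicate k 2
  parts_pos := by
    intro p hp
    rcases Multiset.mem_add.1 hp with h1 | h2
    · exact lam.parts_pos h1
    · rw [Multiset.eq_of_mem_replicate h2]; norm_num
  parts_sum := by
    rw [Multiset.sum_add, lam.parts_sum, Multiset.sum_replicate, smul_eq_mul]
    omega

/-- product of power sums over a multiset -/
def pM (s : Multiset ℕ) : MvPowerSeries ℕ ℚ := (s.map pPow).prod

lemma coeff_pPow (r : ℕ) (d : ℕ →₀ ℕ) :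
    MvPowerSeries.coeff d (pPow r) = if ∃ i : ℕ, d = Finsupp.single i r then (1 : ℚ) else 0 := rfl

lemma coeff_pM {ι : Type*} [Fintype ι] (n : ι → ℕ) (hn : ∀ i, 0 < n i) (d : ℕ →₀ ℕ) :
    MvPowerSeries.coeff d (pM ((Finset.univ : Finset ι).val.map n)) =
      (Nat.card {g : ι → ℕ // ∑ i, Finsupp.single (g i) (n i) = d} : ℚ) := by
  have h1 : pM ((Finset.univ : Finset ι).val.map n) = ∏ i, pPow (n i) := by
    rw [pM, Multiset.map_map]; rfl
  rw [h1, MvPowerSeries.coeff_prod]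
  simp only [coeff_pPow]
  have h2 : ∀ l : ι →₀ (ℕ →₀ ℕ), (∏ i, if ∃ c : ℕ, l i = Finsupp.single c (n i) then (1 : ℚ) else 0)
      = if ∀ i, ∃ c : ℕ, l i = Finsupp.single c (n i) then (1 : ℚ) else 0 := by
    intro l
    rw [Finset.prod_ite_zero]
    simp
  simp only [h2]
  rw [← Finset.sum_filter, Finset.sum_const, nsmul_eq_mul, mul_one]
  norm_cast
  rw [← Nat.card_eq_finsetCard]
  symm
  refine Nat.card_eq_of_bijective (fun g => ⟨Finsupp.equivFunOnFinite.symm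
    (fun i => Finsupp.single (g.1 i) (n i)), ?_⟩) ⟨?_, ?_⟩
  · simp only [Finset.mem_filter, Finset.mem_finsuppAntidiag]
    refine ⟨⟨by simpa using g.2, by simp⟩, fun i => ⟨g.1 i, by simp⟩⟩
  · rintro ⟨g, hg⟩ ⟨g', hg'⟩ h
    simp only [Subtype.mk.injEq, EmbeddingLike.apply_eq_iff_eq] at h
    ext i
    have := congrFun h i
    exact Finsupp.single_left_injective (hn i).ne' this
  · rintro ⟨l, hl⟩
    simp only [Finset.mem_filter, Finset.mem_finsuppAntidiag] at hl
    choose g hg using hl.2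
    refine ⟨⟨g, ?_⟩, ?_⟩
    · rw [← hl.1.1]; exact Finset.sum_congr rfl fun i _ => (hg i).symm
    · ext i : 2
      simp [hg]


/-- multiset of nonzero values of an exponent vector -/
def valM (d : ℕ →₀ ℕ) : Multiset ℕ := d.support.val.map d

lemma sum_single_apply {ι : Type*} [Fintype ι] (n g : ι → ℕ) (c : ℕ) :
    (∑ i, Finsupp.single (g i) (n i) : ℕ →₀ ℕ) c = ∑ i, if g i = c then n i else 0 := by
  simp [Finsupp.finsetSum_apply, Finsupp.single_apply]

lemma sum_single_support {ι : Type*} [Fintype ι] (n g : ι → ℕ) (hn : ∀ i, 0 < n i) :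
    (∑ i, Finsupp.single (g i) (n i) : ℕ →₀ ℕ).support = Finset.univ.image g := by
  ext c
  rw [Finsupp.mem_support_iff, sum_single_apply]
  simp only [ne_eq, Finset.sum_eq_zero_iff, Finset.mem_univ, true_implies, Finset.mem_image,
    true_and, not_forall]
  refine exists_congr fun i => ?_
  have := hn i
  by_cases h : g i = c <;> simp [h]; omega

lemma valM_of_inj {ι : Type*} [Fintype ι] (n g : ι → ℕ) (hn : ∀ i, 0 < n i)
    (hg : Function.Injective g) :
    valM (∑ i, Finsupp.single (g i) (n i)) = (Finset.univ : Finset ι).val.map n := by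
  rw [valM, sum_single_support n g hn, Finset.image_val_of_injOn hg.injOn, Multiset.map_map]
  refine Multiset.map_congr rfl fun i _ => ?_
  rw [Function.comp, sum_single_apply]
  simp [hg.eq_iff]

lemma exists_rep (s : Multiset ℕ) (hs : ∀ x ∈ s, 0 < x) :
    ∃ (k : ℕ) (n : Fin k → ℕ), (∀ i, 0 < n i) ∧ s = (Finset.univ : Finset (Fin k)).val.map n := by
  refine ⟨s.toList.length, s.toList.get, fun i => hs _ ?_, ?_⟩
  · rw [← Multiset.mem_toList]; exact List.get_mem _ _
  · have h := List.ofFn_get s.toList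
    conv_lhs => rw [← Multiset.coe_toList s, ← h]
    simp

lemma coeff_pM_ne (s : Multiset ℕ) (hs : ∀ x ∈ s, 0 < x) (d : ℕ →₀ ℕ)
    (h : MvPowerSeries.coeff d (pM s) ≠ 0) (hc : s.card ≤ (valM d).card) : valM d = s := by
  obtain ⟨k, n, hn, rfl⟩ := exists_rep s hs
  rw [coeff_pM n hn] at h
  have h' : Nat.card {g : Fin k → ℕ // ∑ i, Finsupp.single (g i) (n i) = d} ≠ 0 := by
    exact_mod_cast h
  obtain ⟨⟨g, hg⟩⟩ := (Nat.card_ne_zero.1 h').1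
  subst hg
  refine valM_of_inj n g hn ?_
  rw [valM, sum_single_support n g hn] at hc
  simp only [Multiset.card_map, Finset.card_val] at hc
  have := Finset.card_image_iff.1 (le_antisymm Finset.card_image_le hc)
  simpa using this

lemma exists_coeff_pM (s : Multiset ℕ) (hs : ∀ x ∈ s, 0 < x) :
    ∃ d, valM d = s ∧ MvPowerSeries.coeff d (pM s) ≠ 0 := by
  obtain ⟨k, n, hn, rfl⟩ := exists_rep s hs
  refine ⟨_, valM_of_inj n (fun i => (i : ℕ)) hn Fin.val_injective, ?_⟩
  rw [coeff_pM n hn]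
  have hfin : Finite {g : Fin k → ℕ // ∑ i, Finsupp.single (g i) (n i) =
      ∑ i : Fin k, Finsupp.single (i : ℕ) (n i)} := by
    have : Set.Finite {g : Fin k → ℕ | ∑ i, Finsupp.single (g i) (n i) =
      ∑ i : Fin k, Finsupp.single (i : ℕ) (n i)} := by
      refine (Set.finite_coe_iff.1 (Finite.of_fintype
        (Fintype.piFinset fun _ : Fin k => Finset.range k))).subset ?_
      intro g hg
      simp only [Finset.mem_coe, Fintype.mem_piFinset]
      intro i
      have h1 : g i ∈ Finset.univ.image g := by simp
      rw [← sum_single_support n g hn, hg, sum_single_support n _ hn] at h1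
      simp only [Finset.mem_image, Finset.mem_univ, true_and] at h1
      obtain ⟨j, hj⟩ := h1
      rw [← hj]; simp
    exact this
  have : Nonempty {g : Fin k → ℕ // ∑ i, Finsupp.single (g i) (n i) =
      ∑ i : Fin k, Finsupp.single (i : ℕ) (n i)} := ⟨⟨fun i => (i : ℕ), rfl⟩⟩
  exact_mod_cast Nat.card_pos.ne'

lemma pM_indep (φ : Multiset ℕ →₀ ℚ) (hφ : ∀ s ∈ φ.support, ∀ x ∈ s, 0 < x)
    (h : φ.sum (fun s c => c • pM s) = 0) : φ = 0 := by
  by_contra hne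
  obtain ⟨s, hs, hmax⟩ := Finset.exists_max_image φ.support Multiset.card
    (Finsupp.support_nonempty_iff.2 hne)
  obtain ⟨d, hd, hc⟩ := exists_coeff_pM s (hφ s hs)
  have h1 := congrArg (MvPowerSeries.coeff d) h
  rw [Finsupp.sum, map_sum, Finset.sum_eq_single s] at h1
  · simp only [MvPowerSeries.coeff_smul, map_zero, mul_eq_zero] at h1
    rcases h1 with h1 | h1
    · exact (Finsupp.mem_support_iff.1 hs) h1
    · exact hc h1
  · intro t ht hts
    rw [MvPowerSeries.coeff_smul, mul_eq_zero]
    right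
    by_contra h2
    exact hts ((coeff_pM_ne t (hφ t ht) d h2 (by rw [hd]; exact hmax t ht)).symm.trans hd)
  · intro h2; exact absurd hs h2

/-- colorings of content `d` -/
def contentFin {V : Type*} [Fintype V] (d : ℕ →₀ ℕ) : Finset (V → ℕ) :=
  (Fintype.piFinset fun _ : V => d.support).filter
    fun f => ∀ c : ℕ, Nat.card {v : V // f v = c} = d c

lemma mem_contentFin {V : Type*} [Fintype V] (d : ℕ →₀ ℕ) (f : V → ℕ) :
    f ∈ contentFin d ↔ ∀ c : ℕ, Nat.card {v : V // f v = c} = d c := by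
  simp only [contentFin, Finset.mem_filter, Fintype.mem_piFinset, and_iff_right_iff_imp]
  intro h v
  rw [Finsupp.mem_support_iff, ← h]
  have : Nonempty {w : V // f w = f v} := ⟨⟨v, rfl⟩⟩
  exact Nat.card_pos.ne'

lemma card_content {V : Type*} [Fintype V] (d : ℕ →₀ ℕ) (P : (V → ℕ) → Prop)
    [DecidablePred P] :
    Nat.card {f : V → ℕ // P f ∧ ∀ c : ℕ, Nat.card {v : V // f v = c} = d c} =
      ((contentFin d).filter P).card := by
  rw [← Nat.card_eq_finsetCard]
  refine Nat.card_congr (Equiv.subtypeEquivRight fun f => ?_)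
  rw [Finset.mem_filter, mem_contentFin, and_comm]

lemma compParts_pos {V : Type*} [Fintype V] (H : SimpleGraph V) (c : H.ConnectedComponent) :
    0 < Nat.card c.supp := by
  obtain ⟨v, hv⟩ := c.exists_rep
  have : Nonempty c.supp :=
    ⟨⟨v, by simp only [SimpleGraph.ConnectedComponent.mem_supp_iff]; exact hv⟩⟩
  exact Nat.card_pos

lemma content_comp {V : Type*} [Fintype V] (H : SimpleGraph V) (g : H.ConnectedComponent → ℕ)
    (c : ℕ) : Nat.card {v : V // g (H.connectedComponentMk v) = c} =
      (∑ i, Finsupp.single (g i) (Nat.card i.supp) : ℕ →₀ ℕ) c := by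
  rw [sum_single_apply, Nat.card_eq_fintype_card, Fintype.card_subtype,
    Finset.card_eq_sum_card_fiberwise (f := H.connectedComponentMk) (t := Finset.univ)
      (fun x _ => Finset.mem_univ _)]
  refine Finset.sum_congr rfl fun i _ => ?_
  split_ifs with h
  · rw [Nat.card_eq_fintype_card, Fintype.card_subtype]
    congr 1
    ext v
    simp only [Finset.mem_filter, Finset.mem_univ, true_and,
      SimpleGraph.ConnectedComponent.mem_supp_iff]
    constructor
    · exact fun h => h.2
    · rintro rfl; exact ⟨h, rfl⟩
  · rw [Finset.card_eq_zero, Finset.filter_eq_empty_iff]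
    rintro v hv rfl
    simp at hv
    exact h hv

lemma coeff_pM_comp {V : Type*} [Fintype V] (H : SimpleGraph V) (d : ℕ →₀ ℕ) :
    MvPowerSeries.coeff d (pM (compPartition H).parts) =
      (((contentFin d).filter fun f : V → ℕ => ∀ v w, H.Adj v w → f v = f w).card : ℚ) := by
  rw [← card_content]
  have h := coeff_pM (fun c : H.ConnectedComponent => Nat.card c.supp) (compParts_pos H) d
  refine h.trans ?_
  norm_cast
  refine Nat.card_eq_of_bijective (fun g => ⟨fun v => g.1 (H.connectedComponentMk v), ?_, ?_⟩)
    ⟨?_, ?_⟩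
  · intro v w hvw
    simp only
    rw [SimpleGraph.ConnectedComponent.connectedComponentMk_eq_of_adj hvw]
  · intro c
    rw [content_comp, g.2]
  · rintro ⟨g, hg⟩ ⟨g', hg'⟩ h
    simp only [Subtype.mk.injEq] at h
    ext c
    induction c using SimpleGraph.ConnectedComponent.ind with | _ v
    exact congrFun h v
  · rintro ⟨f, hf, hd⟩
    have hr : ∀ v w, H.Reachable v w → f v = f w := by
      intro v w hvw
      rw [SimpleGraph.reachable_iff_reflTransGen] at hvw
      induction hvw with
      | refl => rfl
      | tail _ h2 ih => exact ih.trans (hf _ _ h2)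
    refine ⟨⟨fun c => Quot.lift f hr c, ?_⟩, rfl⟩
    ext c
    rw [← content_comp]
    exact hd c

lemma stanley {V : Type*} [Fintype V] (G : SimpleGraph V) :
    chromPS G = ∑ S ∈ G.edgeFinset.powerset, ((-1 : ℚ) ^ S.card) •
      pM (compPartition (SimpleGraph.fromEdgeSet (↑S : Set (Sym2 V)))).parts := by
  ext d
  have h0 : MvPowerSeries.coeff d (chromPS G) = (((contentFin d).filter fun f : V → ℕ =>
    ∀ v w, G.Adj v w → f v ≠ f w).card : ℚ) := by
    rw [← card_content]; rfl
  rw [h0, map_sum]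
  simp only [MvPowerSeries.coeff_smul, coeff_pM_comp, Finset.card_filter, Nat.cast_sum,
    Finset.mul_sum]
  rw [Finset.sum_comm]
  refine Finset.sum_congr rfl fun f _ => ?_
  let M : Finset (Sym2 V) := G.edgeFinset.filter fun e => (e.map f).IsDiag
  have h1 : ∀ S ∈ G.edgeFinset.powerset,
      (∀ v w, (SimpleGraph.fromEdgeSet (↑S : Set (Sym2 V))).Adj v w → f v = f w) ↔ S ⊆ M := by
    intro S hS
    rw [Finset.mem_powerset] at hS
    constructor
    · intro h e he
      refine Finset.mem_filter.2 ⟨hS he, ?_⟩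
      have heG := hS he
      induction e with | _ v w
      simp only [SimpleGraph.mem_edgeFinset, SimpleGraph.mem_edgeSet] at heG
      simpa using h v w (by simpa using ⟨he, heG.ne⟩)
    · intro h v w hvw
      rw [SimpleGraph.fromEdgeSet_adj] at hvw
      have := (Finset.mem_filter.1 (h hvw.1)).2
      simpa using this
  have h2 : ∑ S ∈ G.edgeFinset.powerset, (-1 : ℚ) ^ S.card *
      ((if ∀ v w, (SimpleGraph.fromEdgeSet (↑S : Set (Sym2 V))).Adj v w → f v = f w
        then 1 else 0 : ℕ) : ℚ) = ∑ S ∈ M.powerset, (-1 : ℚ) ^ S.card := by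
    have : M.powerset = G.edgeFinset.powerset.filter (fun S => S ⊆ M) := by
      ext S
      simp only [Finset.mem_powerset, Finset.mem_filter]
      exact ⟨fun h => ⟨h.trans (Finset.filter_subset _ _), h⟩, fun h => h.2⟩
    rw [this, Finset.sum_filter]
    refine Finset.sum_congr rfl fun S hS => ?_
    simp only [h1 S hS]
    split_ifs <;> simp
  refine Eq.trans ?_ (Eq.trans h2.symm (Finset.sum_congr rfl fun S _ => by congr))
  have h3 := Finset.sum_powerset_neg_one_pow_card (x := M)
  have h4 : ∑ S ∈ M.powerset, (-1 : ℚ) ^ S.card = if M = ∅ then 1 else 0 := by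
    exact_mod_cast congrArg (Int.cast : ℤ → ℚ) h3
  rw [h4]
  have h5 : (∀ v w, G.Adj v w → f v ≠ f w) ↔ M = ∅ := by
    rw [Finset.filter_eq_empty_iff]
    constructor
    · intro h e he
      induction e with | _ v w
      simpa using h v w (by simpa using he)
    · intro h v w hvw
      simpa using h (x := s(v, w)) (by simpa using hvw)
  simp only [h5]
  split_ifs <;> simp

/-- size of the component of `v` -/
def sz {V : Type*} (H : SimpleGraph V) (v : V) : ℕ := Nat.card {w // H.Reachable v w}

lemma count_parts {V : Type*} [Fintype V] (H : SimpleGraph V) (r : ℕ) :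
    r * (compPartition H).parts.count r = (Finset.univ.filter fun v : V => sz H v = r).card := by
  have hsz : ∀ v, sz H v = Nat.card (H.connectedComponentMk v).supp := by
    intro v
    refine Nat.card_congr (Equiv.subtypeEquivRight fun w => ?_)
    rw [SimpleGraph.ConnectedComponent.mem_supp_iff, SimpleGraph.ConnectedComponent.eq]
    exact ⟨fun h => h.symm, fun h => h.symm⟩
  rw [Finset.card_eq_sum_card_fiberwise (f := H.connectedComponentMk) (t := Finset.univ)
      (fun x _ => Finset.mem_univ _)]
  have h1 : (compPartition H).parts.count r =
      (Finset.univ.filter fun c : H.ConnectedComponent => r = Nat.card c.supp).card := by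
    rw [compPartition, Multiset.count_map]; rfl
  rw [h1, Finset.card_filter, Finset.mul_sum]
  refine Finset.sum_congr rfl fun c _ => ?_
  split_ifs with h
  · rw [mul_one]
    conv_lhs => rw [h, Nat.card_eq_fintype_card, Fintype.card_subtype]
    congr 1
    ext v
    simp only [Finset.mem_filter, Finset.mem_univ, true_and,
      SimpleGraph.ConnectedComponent.mem_supp_iff]
    constructor
    · rintro rfl; exact ⟨(hsz v).trans h.symm, rfl⟩
    · exact fun h => h.2
  · rw [mul_zero, eq_comm, Finset.card_eq_zero, Finset.filter_eq_empty_iff]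
    rintro v hv rfl
    simp only [Finset.mem_filter, Finset.mem_univ, true_and] at hv
    exact h (hv.symm.trans (hsz v))

/-- isolated edges -/
def isoE {V : Type*} (H : SimpleGraph V) (e : Sym2 V) : Prop :=
  e ∈ H.edgeSet ∧ ∀ v ∈ e, ∀ w, H.Adj v w → w ∈ e

lemma isoE.reach {V : Type*} {H : SimpleGraph V} {e : Sym2 V} (he : isoE H e) {v : V}
    (hv : v ∈ e) (w : V) : H.Reachable v w ↔ w ∈ e := by
  constructor
  · intro h
    rw [SimpleGraph.reachable_iff_reflTransGen] at h
    induction h with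
    | refl => exact hv
    | tail _ h2 ih => exact he.2 _ ih _ h2
  · intro hw
    by_cases hvw : v = w
    · subst hvw; exact SimpleGraph.Reachable.refl _
    · have : e = s(v, w) := ((Sym2.mem_and_mem_iff hvw).1 ⟨hv, hw⟩)
      subst this
      exact SimpleGraph.Adj.reachable he.1

lemma card_toFinset_edge {V : Type*} {H : SimpleGraph V} {e : Sym2 V} (he : e ∈ H.edgeSet) :
    e.toFinset.card = 2 :=
  Sym2.card_toFinset_of_not_isDiag e (H.not_isDiag_of_mem_edgeSet he)

lemma isoE.sz_eq {V : Type*} {H : SimpleGraph V} {e : Sym2 V} (he : isoE H e) {v : V}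
    (hv : v ∈ e) : sz H v = 2 := by
  rw [← card_toFinset_edge he.1, ← Nat.card_eq_finsetCard]
  refine Nat.card_congr (Equiv.subtypeEquivRight fun w => ?_)
  rw [he.reach hv, Sym2.mem_toFinset]

lemma isoE.eq_of_mem {V : Type*} {H : SimpleGraph V} {e e' : Sym2 V} (he : isoE H e)
    (he' : isoE H e') {v : V} (hv : v ∈ e) (hv' : v ∈ e') : e = e' := by
  ext w
  rw [← he.reach hv, he'.reach hv']

lemma exists_isoE {V : Type*} {H : SimpleGraph V} {v : V} (h : sz H v = 2) :
    ∃ e, isoE H e ∧ v ∈ e := by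
  have h1 : Set.ncard {w | H.Reachable v w} = 2 := h
  obtain ⟨x, y, hxy, hs⟩ := Set.ncard_eq_two.1 h1
  have hmem : ∀ w, H.Reachable v w ↔ w ∈ s(x, y) := by
    intro w
    have : w ∈ {w | H.Reachable v w} ↔ w ∈ ({x, y} : Set V) := by rw [hs]
    simpa using this
  have hv := (hmem v).1 (SimpleGraph.Reachable.refl v)
  refine ⟨s(x, y), ⟨?_, ?_⟩, hv⟩
  · have hr : H.Reachable x y := ((hmem x).2 (by simp)).symm.trans ((hmem y).2 (by simp))
    rw [SimpleGraph.reachable_iff_reflTransGen] at hr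
    rcases hr.cases_head with h | ⟨z, hz, -⟩
    · exact absurd h hxy
    · have : z ∈ s(x, y) := (hmem z).1 (((hmem x).2 (by simp)).trans hz.reachable)
      rcases Sym2.mem_iff.1 this with rfl | rfl
      · exact absurd rfl hz.ne
      · exact hz
  · intro a ha w haw
    exact (hmem w).1 (((hmem a).2 ha).trans haw.reachable)

lemma count_two {V : Type*} [Fintype V] (H : SimpleGraph V) :
    (compPartition H).parts.count 2 = Fintype.card {e // isoE H e} := by
  have h := count_parts H 2
  have h2 : (Finset.univ.filter fun v : V => sz H v = 2) =
      (Finset.univ.filter (isoE H)).biUnion fun e => e.toFinset := by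
    ext v
    simp only [Finset.mem_filter, Finset.mem_univ, true_and, Finset.mem_biUnion,
      Sym2.mem_toFinset]
    exact ⟨exists_isoE, fun ⟨e, he, hv⟩ => he.sz_eq hv⟩
  rw [h2, Finset.card_biUnion, Finset.sum_congr rfl (g := fun _ => 2), Finset.sum_const,
    smul_eq_mul, mul_comm] at h
  · rw [Fintype.card_subtype]
    convert Nat.eq_of_mul_eq_mul_right two_pos h
  · intro e he
    simp only [Finset.mem_filter, Finset.mem_univ, true_and] at he
    exact card_toFinset_edge he.1
  · intro e he e' he' hne
    simp only [Finset.coe_filter, Finset.mem_filter, Finset.mem_univ, true_and, Set.mem_ofPred_eq] at he he'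
    rw [Function.onFun, Finset.disjoint_left]
    intro v hv hv'
    rw [Sym2.mem_toFinset] at hv hv'
    exact hne (he.eq_of_mem he' hv hv')

lemma parts_split {V : Type*} [Fintype V] (H : SimpleGraph V) {k : ℕ} (m : Fin k → Sym2 V)
    (hm : Function.Injective m) (hiso : ∀ i, isoE H (m i)) :
    (compPartition H).parts =
      (compPartition (SimpleGraph.induce {v : V | ∀ i, v ∉ m i} H)).parts +
        Multiset.replicate k 2 := by
  set W : Set V := {v : V | ∀ i, v ∉ m i} with hW
  have hclosed : ∀ v w, v ∈ W → H.Adj v w → w ∈ W := by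
    intro v w hv hvw i hi
    exact hv i ((hiso i).2 w hi v hvw.symm)
  have hreach : ∀ (v : W) (w : V), H.Reachable v.1 w ↔
      ∃ hw : w ∈ W, (SimpleGraph.induce W H).Reachable v ⟨w, hw⟩ := by
    intro v w
    constructor
    · intro h
      rw [SimpleGraph.reachable_iff_reflTransGen] at h
      induction h with
      | refl => exact ⟨v.2, SimpleGraph.Reachable.refl _⟩
      | @tail b c _ h2 ih =>
        obtain ⟨hb, hr⟩ := ih
        have hc := hclosed _ _ hb h2
        refine ⟨hc, hr.trans (SimpleGraph.Adj.reachable ?_)⟩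
        simpa using h2
    · rintro ⟨hw, h⟩
      exact h.map (SimpleGraph.Embedding.induce W).toHom
  have hsz : ∀ v : W, sz (SimpleGraph.induce W H) v = sz H v.1 := by
    intro v
    refine Nat.card_eq_of_bijective (fun w => ⟨w.1.1, (hreach v _).2 ⟨w.1.2, w.2⟩⟩) ⟨?_, ?_⟩
    · rintro ⟨w, hw⟩ ⟨w', hw'⟩ h
      simp only [Subtype.mk.injEq] at h
      exact Subtype.ext (Subtype.ext h)
    · rintro ⟨w, hw⟩
      obtain ⟨h1, h2⟩ := (hreach v w).1 hw
      exact ⟨⟨⟨w, h1⟩, h2⟩, rfl⟩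
  have hout : (Finset.univ.filter fun v : V => v ∉ W).card = 2 * k := by
    have : (Finset.univ.filter fun v : V => v ∉ W) =
        (Finset.univ : Finset (Fin k)).biUnion fun i => (m i).toFinset := by
      ext v
      simp [hW]
    rw [this, Finset.card_biUnion, Finset.sum_congr rfl (g := fun _ => 2)]
    · simp [mul_comm]
    · intro i _; exact card_toFinset_edge (hiso i).1
    · intro i _ j _ hne
      rw [Function.onFun, Finset.disjoint_left]
      intro v hv hv'
      rw [Sym2.mem_toFinset] at hv hv'
      exact hne (hm ((hiso i).eq_of_mem (hiso j) hv hv'))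
  have hin : ∀ r, (Finset.univ.filter fun v : W => sz (SimpleGraph.induce W H) v = r).card =
      (Finset.univ.filter fun v : V => sz H v = r ∧ v ∈ W).card := by
    intro r
    refine Finset.card_bij (fun v _ => v.1) ?_ ?_ ?_
    · intro v hv
      simp only [Finset.mem_filter, Finset.mem_univ, true_and, hsz] at hv ⊢
      exact ⟨hv, v.2⟩
    · intro v _ w _ h; exact Subtype.ext h
    · intro v hv
      simp only [Finset.mem_filter, Finset.mem_univ, true_and] at hv
      exact ⟨⟨v, hv.2⟩, by simp [hsz, hv.1], rfl⟩
  have hsz2 : ∀ v, v ∉ W → sz H v = 2 := by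
    intro v hv
    simp only [hW, Set.mem_ofPred_eq, not_forall, not_not] at hv
    obtain ⟨i, hi⟩ := hv
    exact (hiso i).sz_eq hi
  ext r
  rcases Nat.eq_zero_or_pos r with rfl | hr
  · rw [Multiset.count_eq_zero_of_notMem, Multiset.count_eq_zero_of_notMem]
    · intro h
      rcases Multiset.mem_add.1 h with h | h
      · exact absurd (Nat.Partition.parts_pos _ h) (lt_irrefl 0)
      · have := Multiset.eq_of_mem_replicate h
        omega
    · intro h
      exact absurd (Nat.Partition.parts_pos _ h) (lt_irrefl 0)
  · refine Nat.eq_of_mul_eq_mul_left hr ?_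
    rw [Multiset.count_add, mul_add, count_parts, count_parts, hin,
      ← Finset.card_filter_add_card_filter_not (s := Finset.univ.filter fun v : V => sz H v = r)
        (fun v => v ∈ W), Finset.filter_filter, Finset.filter_filter, Multiset.count_replicate]
    congr 1
    split_ifs with h2
    · rw [← h2, ← hout]
      congr 1
      ext v
      simp only [Finset.mem_filter, Finset.mem_univ, true_and]
      exact ⟨fun h => h.2, fun h => ⟨hsz2 v h, h⟩⟩
    · rw [mul_zero, Finset.card_eq_zero, Finset.filter_eq_empty_iff]
      rintro v - ⟨h3, h4⟩
      exact h2 ((hsz2 v h4).symm.trans h3)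

/-- graph spanned by an edge set -/
abbrev gS {V : Type*} (S : Finset (Sym2 V)) : SimpleGraph V :=
  SimpleGraph.fromEdgeSet (↑S : Set (Sym2 V))

/-- common value of the matching sums -/
def mVal {V : Type*} [Fintype V] (G : SimpleGraph V) (k : ℕ) : MvPowerSeries ℕ ℚ :=
  ∑ S ∈ G.edgeFinset.powerset, ((-1 : ℚ) ^ S.card * ((-1 : ℚ) ^ k *
    (((compPartition (gS S)).parts.count 2).descFactorial k : ℚ))) •
      pM ((compPartition (gS S)).parts - Multiset.replicate k 2)

lemma mem_edge_gS {V : Type*} [Fintype V] {G : SimpleGraph V} {S : Finset (Sym2 V)}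
    (hS : S ⊆ G.edgeFinset) (e : Sym2 V) : e ∈ (gS S).edgeSet ↔ e ∈ S := by
  rw [SimpleGraph.edgeSet_fromEdgeSet]
  constructor
  · exact fun h => h.1
  · intro h
    exact ⟨h, G.not_isDiag_of_mem_edgeSet (by simpa using hS h)⟩

lemma matching_inj {V : Type*} [Fintype V] {G : SimpleGraph V} {k : ℕ} (m : Matchings G k) :
    Function.Injective m.1 := by
  intro i j h
  by_contra hne
  obtain ⟨v, hv⟩ : ∃ v, v ∈ m.1 i := ⟨_, Sym2.out_fst_mem _⟩
  exact m.2.2 i j hne v ⟨hv, h ▸ hv⟩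

lemma card_match {V : Type*} [Fintype V] (G : SimpleGraph V) (k : ℕ) (S : Finset (Sym2 V))
    (hS : S ⊆ G.edgeFinset) :
    (Finset.univ.filter fun m : Matchings G k => ∀ i, isoE (gS S) (m.1 i)).card =
      ((compPartition (gS S)).parts.count 2).descFactorial k := by
  rw [count_two]
  have h := Fintype.card_embedding_eq (α := Fin k) (β := {e // isoE (gS S) e})
  rw [Fintype.card_fin] at h
  rw [← h, ← Fintype.card_subtype]
  refine Fintype.card_congr ⟨fun m => ⟨fun i => ⟨m.1.1 i, m.2 i⟩, ?_⟩,
    fun g => ⟨⟨fun i => (g i).1, ?_, ?_⟩, ?_⟩, ?_, ?_⟩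
  · intro i j hij
    exact matching_inj m.1 (congrArg Subtype.val hij)
  · intro i
    have := hS ((mem_edge_gS hS _).1 (g i).2.1)
    simpa using this
  · intro i j hne v hv
    exact hne (g.injective (Subtype.ext ((g i).2.eq_of_mem (g j).2 hv.1 hv.2)))
  · intro i; exact (g i).2
  · intro m; rfl
  · intro g; rfl

lemma match_inner_sum {V : Type*} [Fintype V] (G : SimpleGraph V) (k : ℕ) (m : Matchings G k) :
    chromPS (SimpleGraph.induce {v : V | ∀ i, v ∉ m.1 i} G) =
      ∑ S ∈ G.edgeFinset.powerset, if ∀ i, isoE (gS S) (m.1 i) then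
        ((-1 : ℚ) ^ S.card * (-1 : ℚ) ^ k) •
          pM ((compPartition (gS S)).parts - Multiset.replicate k 2) else 0 := by
  rw [stanley, ← Finset.sum_filter]
  set W : Set V := {v : V | ∀ i, v ∉ m.1 i} with hW
  have hvi : Function.Injective (Sym2.map (Subtype.val : W → V)) :=
    Sym2.map.injective Subtype.val_injective
  have hmem : ∀ (T : Finset (Sym2 W)) (e : Sym2 V),
      e ∈ T.image (Sym2.map Subtype.val) ∪ Finset.univ.image m.1 ↔
        (∃ t ∈ T, Sym2.map Subtype.val t = e) ∨ ∃ i, m.1 i = e := by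
    intro T e; simp
  have hnot : ∀ (t : Sym2 W) (i : Fin k) (v : V), v ∈ Sym2.map Subtype.val t → v ∉ m.1 i := by
    intro t i v hv
    obtain ⟨w, -, rfl⟩ := Sym2.mem_map.1 hv
    exact w.2 i
  have hdisj : ∀ (t : Sym2 W) (i : Fin k), Sym2.map Subtype.val t ≠ m.1 i := by
    intro t i h
    exact hnot t i _ (Sym2.out_fst_mem _) (h ▸ Sym2.out_fst_mem _)
  have hsub : ∀ T ∈ (SimpleGraph.induce W G).edgeFinset.powerset,
      T.image (Sym2.map Subtype.val) ∪ Finset.univ.image m.1 ⊆ G.edgeFinset := by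
    intro T hT e he
    rw [Finset.mem_powerset] at hT
    rcases (hmem T e).1 he with ⟨t, ht, rfl⟩ | ⟨i, rfl⟩
    · have := hT ht
      induction t with | _ a b
      simpa using this
    · simpa using m.2.1 i
  -- compute back
  have hback : ∀ T : Finset (Sym2 W), (Finset.univ.filter fun t : Sym2 W =>
      Sym2.map Subtype.val t ∈ T.image (Sym2.map Subtype.val) ∪ Finset.univ.image m.1) = T := by
    intro T
    ext t
    rw [Finset.mem_filter, hmem]
    constructor
    · rintro ⟨-, ⟨t', ht', h⟩ | ⟨i, h⟩⟩
      · rwa [← hvi h]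
      · exact absurd h.symm (hdisj t i)
    · intro h; exact ⟨Finset.mem_univ _, Or.inl ⟨t, h, rfl⟩⟩
  have hgs : ∀ S : Finset (Sym2 V), gS (Finset.univ.filter fun t : Sym2 W =>
      Sym2.map Subtype.val t ∈ S) = SimpleGraph.induce W (gS S) := by
    intro S
    ext a b
    simp [Subtype.ext_iff]
  have hisoT : ∀ T ∈ (SimpleGraph.induce W G).edgeFinset.powerset, ∀ i,
      isoE (gS (T.image (Sym2.map Subtype.val) ∪ Finset.univ.image m.1)) (m.1 i) := by
    intro T hT i
    refine ⟨(mem_edge_gS (hsub T hT) _).2 ((hmem _ _).2 (Or.inr ⟨i, rfl⟩)), ?_⟩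
    intro v hv w hvw
    rw [SimpleGraph.fromEdgeSet_adj, Finset.mem_coe, hmem] at hvw
    rcases hvw.1 with ⟨t, ht, h⟩ | ⟨j, h⟩
    · exact absurd hv (hnot t i v (by rw [h]; simp))
    · by_cases hij : i = j
      · subst hij; rw [h]; simp
      · exact absurd ⟨hv, by rw [h]; simp⟩ (m.2.2 i j hij v)
  refine Finset.sum_bij' (fun T _ => T.image (Sym2.map Subtype.val) ∪ Finset.univ.image m.1)
    (fun S _ => Finset.univ.filter fun t : Sym2 W => Sym2.map Subtype.val t ∈ S) ?_ ?_ ?_ ?_ ?_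
  · intro T hT
    rw [Finset.mem_filter, Finset.mem_powerset]
    exact ⟨hsub T hT, hisoT T hT⟩
  · intro S hS
    rw [Finset.mem_filter, Finset.mem_powerset] at hS
    rw [Finset.mem_powerset]
    intro t ht
    have := hS.1 (Finset.mem_filter.1 ht).2
    induction t with | _ a b
    simpa using this
  · intro T hT
    exact hback T
  · intro S hS
    rw [Finset.mem_filter, Finset.mem_powerset] at hS
    ext e
    rw [hmem]
    constructor
    · rintro (⟨t, ht, rfl⟩ | ⟨i, rfl⟩)
      · exact (Finset.mem_filter.1 ht).2
      · exact (mem_edge_gS hS.1 _).1 (hS.2 i).1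
    · intro he
      by_cases h : ∃ i, m.1 i = e
      · exact Or.inr h
      · left
        have heG := (mem_edge_gS hS.1 e).2 he
        have hno : ∀ v ∈ e, v ∈ W := by
          intro v hv i hi
          apply h
          refine ⟨i, ?_⟩
          obtain ⟨w, rfl⟩ := hv
          have hw := (hS.2 i).2 v hi w heG
          exact (Sym2.mem_and_mem_iff (SimpleGraph.Adj.ne ((gS S).mem_edgeSet.1 heG))).1 ⟨hi, hw⟩
        induction e with | _ a b
        exact ⟨s(⟨a, hno a (by simp)⟩, ⟨b, hno b (by simp)⟩), by simpa using he, by simp⟩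
  · intro T hT
    set S := T.image (Sym2.map Subtype.val) ∪ Finset.univ.image m.1 with hSdef
    have hcard : S.card = T.card + k := by
      rw [hSdef, Finset.card_union_of_disjoint, Finset.card_image_of_injective _ hvi,
        Finset.card_image_of_injective _ (matching_inj m), Finset.card_univ, Fintype.card_fin]
      rw [Finset.disjoint_left]
      intro e he he'
      obtain ⟨t, -, rfl⟩ := Finset.mem_image.1 he
      obtain ⟨i, -, h⟩ := Finset.mem_image.1 he'
      exact hdisj t i h.symm
    have hp := parts_split (gS S) m.1 (matching_inj m) (hisoT T hT)
    have hT2 := hgs S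
    rw [hback T] at hT2
    rw [hp, add_tsub_cancel_right, hcard, pow_add, mul_assoc, ← mul_pow]
    simp only [mul_neg, mul_one, neg_neg, one_pow]
    congr 4

lemma matching_sum {V : Type*} [Fintype V] (G : SimpleGraph V) (k : ℕ) :
    ∑ m : Matchings G k, chromPS (SimpleGraph.induce {v : V | ∀ i, v ∉ m.1 i} G) = mVal G k := by
  rw [Finset.sum_congr rfl fun m _ => match_inner_sum G k m, Finset.sum_comm, mVal]
  refine Finset.sum_congr rfl fun S hS => ?_
  rw [← Finset.sum_filter, Finset.sum_const, card_match G k S (Finset.mem_powerset.1 hS),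
    ← Nat.cast_smul_eq_nsmul ℚ, smul_smul]
  congr 1
  ring

/-- formal combination of partitions -/
def phi {V : Type*} [Fintype V] (G : SimpleGraph V) : Multiset ℕ →₀ ℚ :=
  ∑ S ∈ G.edgeFinset.powerset, Finsupp.single (compPartition (gS S)).parts ((-1 : ℚ) ^ S.card)

lemma chromPS_phi {V : Type*} [Fintype V] (G : SimpleGraph V) :
    chromPS G = Finsupp.linearCombination ℚ pM (phi G) := by
  rw [stanley, phi, map_sum]
  simp only [Finsupp.linearCombination_single]

lemma mVal_phi {V : Type*} [Fintype V] (G : SimpleGraph V) (k : ℕ) :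
    mVal G k = Finsupp.linearCombination ℚ (fun s : Multiset ℕ => ((-1 : ℚ) ^ k *
      ((s.count 2).descFactorial k : ℚ)) • pM (s - Multiset.replicate k 2)) (phi G) := by
  rw [mVal, phi, map_sum]
  simp only [Finsupp.linearCombination_single, smul_smul]

lemma phi_pos {V : Type*} [Fintype V] (G : SimpleGraph V) (s : Multiset ℕ) (h : phi G s ≠ 0) :
    ∀ x ∈ s, 0 < x := by
  rw [phi, Finsupp.finsetSum_apply] at h
  obtain ⟨S, -, hS⟩ := Finset.exists_ne_zero_of_sum_ne_zero h
  rw [Finsupp.single_apply] at hS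
  split_ifs at hS with h1
  · rw [← h1]; exact fun x hx => Nat.Partition.parts_pos _ hx
  · exact absurd rfl hS

lemma phi_eq {V₁ V₂ : Type*} [Fintype V₁] [Fintype V₂]
    (G₁ : SimpleGraph V₁) (G₂ : SimpleGraph V₂) (h : chromPS G₁ = chromPS G₂) :
    phi G₁ = phi G₂ := by
  rw [← sub_eq_zero]
  refine pM_indep _ ?_ ?_
  · intro s hs
    rw [Finsupp.mem_support_iff, Finsupp.sub_apply] at hs
    by_cases h1 : phi G₁ s = 0
    · refine phi_pos G₂ s fun h2 => hs (by rw [h1, h2, sub_zero])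
    · exact phi_pos G₁ s h1
  · have : Finsupp.linearCombination ℚ pM (phi G₁ - phi G₂) = 0 := by
      rw [map_sub, ← chromPS_phi, ← chromPS_phi, h, sub_self]
    exact this

lemma mVal_partition {V : Type*} [Fintype V] (G : SimpleGraph V) (k : ℕ)
    (hk : 2 * k ≤ Fintype.card V) :
    mVal G k = ∑ lam : Nat.Partition (Fintype.card V - 2 * k),
        ((-1 : ℚ) ^ k * cCoef G (addTwos hk lam) *
            ((mTwo lam + k).choose k : ℚ) * (k.factorial : ℚ)) • pPart lam := by
  simp only [cCoef, Finset.mul_sum, Finset.sum_mul, Finset.sum_smul]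
  rw [Finset.sum_comm, mVal]
  refine Finset.sum_congr rfl fun S _ => ?_
  have key : ∀ lam : Nat.Partition (Fintype.card V - 2 * k),
      compPartition (gS S) = addTwos hk lam →
      (compPartition (gS S)).parts = lam.parts + Multiset.replicate k 2 :=
    fun lam h => congrArg Nat.Partition.parts h
  by_cases hc : k ≤ (compPartition (gS S)).parts.count 2
  · have hle : Multiset.replicate k 2 ≤ (compPartition (gS S)).parts :=
      Multiset.le_count_iff_replicate_le.1 hc
    have hadd := tsub_add_cancel_of_le hle
    let mu : Nat.Partition (Fintype.card V - 2 * k) :=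
      { parts := (compPartition (gS S)).parts - Multiset.replicate k 2
        parts_pos := fun {i} hi => (compPartition (gS S)).parts_pos
          (Multiset.mem_of_le (Multiset.sub_le_self _ _) hi)
        parts_sum := by
          have h1 := congrArg Multiset.sum hadd
          rw [Multiset.sum_add, (compPartition (gS S)).parts_sum, Multiset.sum_replicate,
            smul_eq_mul] at h1
          omega }
    have hmu : compPartition (gS S) = addTwos hk mu := Nat.Partition.ext hadd.symm
    rw [Finset.sum_eq_single mu]
    · have h2 : (compPartition (gS S)).parts.count 2 = mTwo mu + k := by
        rw [key mu hmu, Multiset.count_add, Multiset.count_replicate_self]; rfl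
      rw [if_pos hmu, h2, Nat.descFactorial_eq_factorial_mul_choose]
      change _ = _ • pM ((compPartition (gS S)).parts - Multiset.replicate k 2)
      congr 1
      push_cast
      ring
    · intro lam _ hne
      rw [if_neg]
      · simp
      · intro h
        apply hne
        apply Nat.Partition.ext
        change _ = (compPartition (gS S)).parts - Multiset.replicate k 2
        rw [key lam h, add_tsub_cancel_right]
    · intro h; exact absurd (Finset.mem_univ _) h
  · rw [Nat.descFactorial_of_lt (not_le.1 hc), Finset.sum_eq_zero]
    · simp
    · intro lam _
      rw [if_neg]
      · simp
      · intro h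
        apply hc
        rw [key lam h, Multiset.count_add, Multiset.count_replicate_self]
        omega

/-- With `c_λ` as above, the matching sums satisfy
`∑_{m ∈ ℳ_k(G)} Ψ(G ∖ 𝒩(m)) = ∑_{λ ⊢ n−2k} (−1)^k c_{λ∪(2^k)} (m₂(λ)+k choose k) k! ⬝ p_λ`;
in particular, if `Ψ(G₁) = Ψ(G₂)` then the matching sums of `G₁` and `G₂` agree. -/
theorem stmt19 {V₁ V₂ : Type*} [Fintype V₁] [Fintype V₂]
    (G₁ : SimpleGraph V₁) (G₂ : SimpleGraph V₂) (k : ℕ)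
    (hk₁ : 2 * k ≤ Fintype.card V₁) (hk₂ : 2 * k ≤ Fintype.card V₂) :
    (∑ m : Matchings G₁ k,
        chromPS (SimpleGraph.induce {v : V₁ | ∀ i, v ∉ m.1 i} G₁) =
      ∑ lam : Nat.Partition (Fintype.card V₁ - 2 * k),
        ((-1 : ℚ) ^ k * cCoef G₁ (addTwos hk₁ lam) *
            ((mTwo lam + k).choose k : ℚ) * (k.factorial : ℚ)) • pPart lam) ∧
      (chromPS G₁ = chromPS G₂ →
        ∑ m : Matchings G₁ k,
            chromPS (SimpleGraph.induce {v : V₁ | ∀ i, v ∉ m.1 i} G₁) =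
          ∑ m : Matchings G₂ k,
            chromPS (SimpleGraph.induce {v : V₂ | ∀ i, v ∉ m.1 i} G₂)) := by
  refine ⟨?_, fun h => ?_⟩
  · rw [matching_sum, mVal_partition G₁ k hk₁]
  · rw [matching_sum, matching_sum, mVal_phi, mVal_phi, phi_eq G₁ G₂ h]

end
end
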